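/- Let p be a prime and let n > 1 be an integer with p > 2n. If G is an extraspecial p-group of order p^(2n+1), then every automorphism of G whose order is a power of p satisfies α^p = 1; in particular G has no automorphism of order p^2. -/

import Mathlib

/-- A finite group `G` is an extraspecial `p`-group if its center, derived subgroup
and Frattini subgroup all coincide and have order `p`. -/
def IsExtraspecial (p : ℕ) (G : Type*) [Group G] : Prop :=
  IsPGroup p G ∧ Subgroup.center G = commutator G ∧
    commutator G = frattini G ∧ Nat.card (Subgroup.center G) = p

section Nilpotent

variable {A : Type*} [AddCommGroup A]

/-- A nilpotent endomorphism is killed on an invariant subgroup of order dividing `p ^ m`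
by its `m`-th power. -/
theorem pow_apply_eq_zero_of_isNilpotent_of_card_dvd [Finite A] {p : ℕ} (hp : p.Prime)
    {N : AddMonoid.End A} (hN : IsNilpotent N) (m : ℕ) (H : AddSubgroup A)
    (hH : H.map N ≤ H) (hcard : Nat.card H ∣ p ^ m) {x : A} (hx : x ∈ H) :
    (N ^ m) x = 0 := by
  induction m generalizing H x with
  | zero =>
    have hbot : H = ⊥ := AddSubgroup.card_eq_one.mp (by simpa using hcard)
    simpa [hbot] using hx
  | succ m ih =>
    rw [pow_succ]
    change (N ^ m) (N x) = 0
    by_cases hK : H.map N = H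
    · obtain ⟨k, hk⟩ := hN
      have hsurj : ∀ j : ℕ, ∃ z ∈ H, (N ^ j) z = x := by
        intro j
        induction j with
        | zero => exact ⟨x, hx, rfl⟩
        | succ j ihj =>
          obtain ⟨z, hz, hzx⟩ := ihj
          rw [← hK] at hz
          obtain ⟨w, hw, rfl⟩ := hz
          exact ⟨w, hw, by rw [← hzx, pow_succ]; rfl⟩
      obtain ⟨z, -, rfl⟩ := hsurj k
      simp [hk]
    · refine ih (H.map N) (AddSubgroup.map_mono hH) ?_ (AddSubgroup.mem_map_of_mem N hx)
      obtain ⟨i, hi, hHi⟩ := (Nat.dvd_prime_pow hp).mp hcard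
      have hdvd := AddSubgroup.card_dvd_of_le hH
      obtain ⟨j, hj, hKj⟩ := (Nat.dvd_prime_pow hp).mp (hdvd.trans hcard)
      rw [hKj]
      apply pow_dvd_pow
      by_contra hlt
      refine hK (AddSubgroup.eq_of_le_of_card_ge hH ?_)
      rw [hKj, hHi]
      exact Nat.pow_le_pow_right hp.pos (by omega)

/-- An endomorphism `β` with `β ^ p ^ k = 1` of an abelian group of order `p ^ m` satisfies
`(β - 1) ^ m = 0`. -/
theorem sub_one_pow_eq_zero_of_pow_prime_pow_eq_one {p m k : ℕ} (hp : p.Prime)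
    (hcard : Nat.card A = p ^ m) {β : AddMonoid.End A} (hβ : β ^ p ^ k = 1) :
    (β - 1) ^ m = 0 := by
  have : Finite A := Nat.finite_of_card_ne_zero (by rw [hcard]; exact pow_ne_zero _ hp.ne_zero)
  have hpm : ((p : AddMonoid.End A)) ^ m = 0 := by
    ext x
    rw [← Nat.cast_pow, ← hcard, AddMonoid.End.natCast_apply]
    exact card_nsmul_eq_zero'
  have hnil : IsNilpotent (β - 1) := by
    obtain ⟨r, hr⟩ : ∃ r, β ^ p ^ k = (β - 1) ^ p ^ k + 1 + p * r := by
      obtain ⟨r, hr⟩ := (Commute.one_right (β - 1)).exists_add_pow_prime_pow_eq hp k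
      exact ⟨(β - 1) * r, by simpa [mul_assoc] using hr⟩
    have hpr : (β - 1) ^ p ^ k = -((p : AddMonoid.End A) * r) := by
      rw [hβ, add_right_comm, right_eq_add] at hr
      exact eq_neg_of_add_eq_zero_left hr
    refine ⟨p ^ k * m, ?_⟩
    rw [pow_mul, hpr, neg_pow, (Nat.cast_commute p r).mul_pow, hpm]
    simp
  ext x
  exact pow_apply_eq_zero_of_isNilpotent_of_card_dvd hp hnil m ⊤ le_top
    (by simp [hcard]) (AddSubgroup.mem_top x)

end Nilpotent

section Baer

variable {G : Type*} [Group G]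

open Subgroup
open scoped commutatorElement

theorem commutatorElement_mul_left_of_mem_center
    (h : ∀ x y : G, ⁅x, y⁆ ∈ center G) (x y z : G) : ⁅x * y, z⁆ = ⁅x, z⁆ * ⁅y, z⁆ := by
  calc ⁅x * y, z⁆ = x * ⁅y, z⁆ * (z * x⁻¹ * z⁻¹) := by simp only [commutatorElement_def]; group
    _ = ⁅y, z⁆ * x * (z * x⁻¹ * z⁻¹) := by rw [mem_center_iff.mp (h y z) x]
    _ = ⁅y, z⁆ * ⁅x, z⁆ := by simp only [commutatorElement_def]; group
    _ = ⁅x, z⁆ * ⁅y, z⁆ := (mem_center_iff.mp (h y z) _).symm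

theorem commutatorElement_mul_right_of_mem_center
    (h : ∀ x y : G, ⁅x, y⁆ ∈ center G) (x y z : G) : ⁅x, y * z⁆ = ⁅x, y⁆ * ⁅x, z⁆ := by
  rw [← commutatorElement_inv, commutatorElement_mul_left_of_mem_center h, mul_inv_rev,
    commutatorElement_inv, commutatorElement_inv, mem_center_iff.mp (h x y) _]

theorem commutatorElement_pow_left_of_mem_center
    (h : ∀ x y : G, ⁅x, y⁆ ∈ center G) (x y : G) (k : ℕ) : ⁅x ^ k, y⁆ = ⁅x, y⁆ ^ k := by
  induction k with
  | zero => simp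
  | succ k ih => rw [pow_succ, commutatorElement_mul_left_of_mem_center h, ih, pow_succ]

theorem commutatorElement_eq_one_of_mem_center_left {z : G} (hz : z ∈ center G) (x : G) :
    ⁅z, x⁆ = 1 :=
  commutatorElement_eq_one_iff_mul_comm.mpr (mem_center_iff.mp hz x).symm

theorem commutatorElement_eq_one_of_mem_center_right {z : G} (hz : z ∈ center G) (x : G) :
    ⁅x, z⁆ = 1 :=
  commutatorElement_eq_one_iff_mul_comm.mpr (mem_center_iff.mp hz x)

/-- The Baer correspondence: if commutators are central and have `m`-th powers as square roots,
then `x + y = x * y * ⁅y, x⁆ ^ m` is an abelian group structure. -/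
abbrev baerAddCommGroup (m : ℕ) (h : ∀ x y : G, ⁅x, y⁆ ∈ center G)
    (hm : ∀ x y : G, ⁅x, y⁆ ^ (2 * m) = ⁅x, y⁆) : AddCommGroup G where
  add x y := x * y * ⁅y, x⁆ ^ m
  zero := 1
  neg x := x⁻¹
  nsmul k x := x ^ k
  zsmul k x := x ^ k
  nsmul_zero x := pow_zero x
  nsmul_succ k x := by
    change x ^ (k + 1) = x ^ k * x * ⁅x, x ^ k⁆ ^ m
    rw [commutatorElement_eq_one_iff_mul_comm.mpr (Commute.self_pow x k), one_pow, mul_one,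
      pow_succ]
  zsmul_zero' x := zpow_zero x
  zsmul_succ' k x := by
    change x ^ ((k + 1 : ℕ) : ℤ) = x ^ (k : ℤ) * x * ⁅x, x ^ (k : ℤ)⁆ ^ m
    rw [commutatorElement_eq_one_iff_mul_comm.mpr (Commute.self_zpow x k), one_pow, mul_one,
      Nat.cast_succ, zpow_add_one]
  zsmul_neg' k x := by
    change x ^ Int.negSucc k = (x ^ ((k + 1 : ℕ) : ℤ))⁻¹
    rw [zpow_negSucc, zpow_natCast]
  zero_add x := by
    change 1 * x * ⁅x, 1⁆ ^ m = x
    simp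
  add_zero x := by
    change x * 1 * ⁅1, x⁆ ^ m = x
    simp
  neg_add_cancel x := by
    change x⁻¹ * x * ⁅x, x⁻¹⁆ ^ m = 1
    simp [commutatorElement_def]
  add_comm x y := by
    change x * y * ⁅y, x⁆ ^ m = y * x * ⁅x, y⁆ ^ m
    have hyx : y * x = x * y * ⁅y, x⁆ := by
      rw [mem_center_iff.mp (h y x)]; simp [commutatorElement_def]
    rw [← commutatorElement_inv y x, hyx, mul_assoc (x * y), inv_pow]
    congr 1
    rw [eq_mul_inv_iff_mul_eq, ← pow_add, ← two_mul, hm]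
  add_assoc x y z := by
    change x * y * ⁅y, x⁆ ^ m * z * ⁅z, x * y * ⁅y, x⁆ ^ m⁆ ^ m =
      x * (y * z * ⁅z, y⁆ ^ m) * ⁅y * z * ⁅z, y⁆ ^ m, x⁆ ^ m
    have hc : ∀ x y : G, ⁅x, y⁆ ^ m ∈ center G := fun x y => pow_mem (h x y) m
    have hcomm : ∀ a b c d : G, Commute ⁅a, b⁆ ⁅c, d⁆ :=
      fun a b c d => mem_center_iff.mp (h c d) _
    simp only [commutatorElement_mul_left_of_mem_center h,
      commutatorElement_mul_right_of_mem_center h,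
      commutatorElement_eq_one_of_mem_center_left (hc _ _),
      commutatorElement_eq_one_of_mem_center_right (hc _ _), mul_one, (hcomm _ _ _ _).mul_pow]
    rw [mul_assoc (x * y), ← mem_center_iff.mp (hc y x) z]
    simp only [mul_assoc]
    congr 3
    rw [← mul_assoc, mem_center_iff.mp (hc z y)]

end Baer

open scoped IsMulCommutative in
/-- An automorphism of `p`-power order fixes a center of order `p` pointwise. -/
theorem apply_eq_self_of_mem_center_of_pow_prime_pow_eq_one {p k : ℕ} (hp : p.Prime)
    {G : Type*} [Group G] (hcard : Nat.card (Subgroup.center G) = p) {α : MulAut G}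
    (hα : α ^ p ^ k = 1) {z : G} (hz : z ∈ Subgroup.center G) : α z = z := by
  let β : AddMonoid.End (Additive (Subgroup.center G)) :=
    MonoidHom.toAdditive (Subgroup.centerCongr α).toMonoidHom
  have hβ_apply (j : ℕ) (x : Additive (Subgroup.center G)) :
      ((((β ^ j) x).toMul : Subgroup.center G) : G) = (α ^ j) (x.toMul : G) := by
    induction j generalizing x with
    | zero => rfl
    | succ j ih =>
      rw [pow_succ, pow_succ]
      exact ih (β x)
  have hβ : β ^ p ^ k = 1 := by
    ext x
    simpa [hα] using hβ_apply (p ^ k) x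
  have hsub := sub_one_pow_eq_zero_of_pow_prime_pow_eq_one
    (A := Additive (Subgroup.center G)) (m := 1) hp ((pow_one p).symm ▸ hcard) hβ
  rw [pow_one, sub_eq_zero] at hsub
  have h := hβ_apply 1 (Additive.ofMul ⟨z, hz⟩)
  simpa [hsub] using h.symm

open scoped commutatorElement in
theorem extraspecial_pPowOrder_aut_pow_p_eq_one (p n : ℕ) (hp : p.Prime)
    (hn : 1 < n) (hpn : 2 * n < p) (G : Type*) [Group G] [Finite G]
    (hG : IsExtraspecial p G) (hcard : Nat.card G = p ^ (2 * n + 1)) :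
    (∀ α : MulAut G, (∃ k : ℕ, orderOf α = p ^ k) → α ^ p = 1) ∧
      ¬ ∃ α : MulAut G, orderOf α = p ^ 2 := by
  obtain ⟨-, hcenter, -, hcard_center⟩ := hG
  have key : ∀ α : MulAut G, (∃ k : ℕ, orderOf α = p ^ k) → α ^ p = 1 := by
    rintro α ⟨k, hk⟩
    have hα : α ^ p ^ k = 1 := hk ▸ pow_orderOf_eq_one α
    have hcomm (x y : G) : ⁅x, y⁆ ∈ Subgroup.center G := by
      rw [hcenter]
      exact Subgroup.commutator_mem_commutator (Subgroup.mem_top x) (Subgroup.mem_top y)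
    have hcomm_pow (x y : G) : ⁅x, y⁆ ^ p = 1 := by
      rw [← hcard_center]
      exact congrArg Subtype.val (pow_card_eq_one' (x := (⟨_, hcomm x y⟩ : Subgroup.center G)))
    have hpow_mem (x : G) : x ^ p ∈ Subgroup.center G := by
      refine Subgroup.mem_center_iff.mpr fun y => ?_
      rw [eq_comm, ← commutatorElement_eq_one_iff_mul_comm,
        commutatorElement_pow_left_of_mem_center hcomm, hcomm_pow]
    obtain ⟨m, hm⟩ : ∃ m, 2 * m = p + 1 := by
      obtain ⟨j, hj⟩ := hp.odd_of_ne_two (by omega)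
      exact ⟨j + 1, by omega⟩
    let _ : AddCommGroup G := baerAddCommGroup m hcomm fun x y => by
      rw [hm, pow_succ, hcomm_pow, one_mul]
    let β : AddMonoid.End G :=
      { toFun := α
        map_zero' := map_one α
        map_add' := fun x y => by
          change α (x * y * ⁅y, x⁆ ^ m) = α x * α y * ⁅α y, α x⁆ ^ m
          rw [map_mul, map_mul, map_pow, map_commutatorElement] }
    have hβ_apply (j : ℕ) (x : G) : (β ^ j) x = (α ^ j) x := by
      induction j generalizing x with
      | zero => rfl
      | succ j ih =>
        rw [pow_succ, pow_succ]
        exact ih (α x)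
    have hβ : β ^ p ^ k = 1 := by
      ext x
      rw [hβ_apply, hα]
      rfl
    have hnil : (β - 1) ^ p = 0 :=
      pow_eq_zero_of_le hpn (sub_one_pow_eq_zero_of_pow_prime_pow_eq_one hp hcard hβ)
    have hp_mul : (p : AddMonoid.End G) * (β - 1) = 0 := by
      rw [(Nat.cast_commute p (β - 1)).eq, sub_mul, one_mul, sub_eq_zero]
      ext x
      exact apply_eq_self_of_mem_center_of_pow_prime_pow_eq_one hp hcard_center hα (hpow_mem x)
    have hβp : β ^ p = 1 := by
      obtain ⟨r, hr⟩ := (Commute.one_right (β - 1)).exists_add_pow_prime_eq hp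
      simpa [hnil, hp_mul] using hr
    ext x
    rw [← hβ_apply, hβp]
    rfl
  refine ⟨key, ?_⟩
  rintro ⟨α, hα⟩
  have hdvd := orderOf_dvd_of_pow_eq_one (key α ⟨2, hα⟩)
  rw [hα] at hdvd
  have hle := Nat.le_of_dvd hp.pos hdvd
  nlinarith [hp.two_le]
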